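/- For every subgroup G of the symmetric group on the 9 coordinates, there exists a 2-colouring of K(C_9) containing no monochromatic planar K_4 that is invariant under G. -/

import Mathlib

/-- The vertex `v : Fin n → Bool` of the hypercube, regarded as a point of `ℝ^n`. -/
def toPoint (n : ℕ) (v : Fin n → Bool) : Fin n → ℝ := fun i => if v i then 1 else 0

/-- The colouring `c` of the edges of `K(C_n)` contains no monochromatic planar `K₄`:
no four distinct coplanar vertices have all six connecting edges the same colour. -/
def NoMonoPlanarK4 (n : ℕ) (c : Sym2 (Fin n → Bool) → Bool) : Prop :=
  ∀ a b d e : Fin n → Bool,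
    a ≠ b → a ≠ d → a ≠ e → b ≠ d → b ≠ e → d ≠ e →
    Coplanar ℝ ({toPoint n a, toPoint n b, toPoint n d, toPoint n e} : Set (Fin n → ℝ)) →
    ¬ (c s(a, b) = c s(a, d) ∧ c s(a, b) = c s(a, e) ∧
       c s(a, b) = c s(b, d) ∧ c s(a, b) = c s(b, e) ∧ c s(a, b) = c s(d, e))

/-- The action of a coordinate permutation on a vertex of the hypercube:
`(σ • v) i = v (σ⁻¹ i)`. -/
def permAct (n : ℕ) (σ : Equiv.Perm (Fin n)) (v : Fin n → Bool) : Fin n → Bool :=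
  fun i => v (σ⁻¹ i)

/-- The colouring `c` is invariant under the subgroup `G` of coordinate permutations. -/
def InvariantUnder (n : ℕ) (G : Subgroup (Equiv.Perm (Fin n)))
    (c : Sym2 (Fin n → Bool) → Bool) : Prop :=
  ∀ σ ∈ G, ∀ u v : Fin n → Bool, u ≠ v →
    c s(permAct n σ u, permAct n σ v) = c s(u, v)

/-- The number of coordinates in which `u` is `1` and `v` is `0`. -/
def excess {n : ℕ} (u v : Fin n → Bool) : ℕ := ∑ i, (u i && !v i).toNat

/-- The number of coordinates in which both `u` and `v` are `1`. -/
def overlap {n : ℕ} (u v : Fin n → Bool) : ℕ := ∑ i, (u i && v i).toNat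

theorem overlap_comm {n : ℕ} (u v : Fin n → Bool) : overlap u v = overlap v u := by
  simp only [overlap, Bool.and_comm]

theorem excess_permAct {n : ℕ} (σ : Equiv.Perm (Fin n)) (u v : Fin n → Bool) :
    excess (permAct n σ u) (permAct n σ v) = excess u v :=
  Equiv.sum_comp σ⁻¹ fun i => (u i && !v i).toNat

theorem overlap_permAct {n : ℕ} (σ : Equiv.Perm (Fin n)) (u v : Fin n → Bool) :
    overlap (permAct n σ u) (permAct n σ v) = overlap u v :=
  Equiv.sum_comp σ⁻¹ fun i => (u i && v i).toNat

/-- The colour of an edge `{u, v}` with `excess u v = a`, `excess v u = b`, `overlap u v = c`.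
It depends only on the unordered pair `{a, b}`, encoded for `a, b ≤ 9` as the two-digit
number `10 * min a b + max a b`, and the parity of `c`. -/
def typeColour (a b c : ℕ) : Bool :=
  bif Nat.beq (c % 2) 0 then
    [1, 2, 3, 4, 13, 15, 33, 44].all fun k => !Nat.beq (10 * min a b + max a b) k
  else
    [1, 4, 6, 11, 12, 22, 24, 34, 35].all fun k => !Nat.beq (10 * min a b + max a b) k

theorem typeColour_comm (a b c : ℕ) : typeColour a b c = typeColour b a c := by
  simp only [typeColour, min_comm, max_comm]

/-- The edge colouring of `K(C_n)` induced by `typeColour`. -/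
def typeColouring (n : ℕ) : Sym2 (Fin n → Bool) → Bool :=
  Sym2.lift ⟨fun u v => typeColour (excess u v) (excess v u) (overlap u v), fun u v => by
    simp only [typeColour_comm (excess u v), overlap_comm u v]⟩

theorem typeColouring_mk {n : ℕ} (u v : Fin n → Bool) :
    typeColouring n s(u, v) = typeColour (excess u v) (excess v u) (overlap u v) := rfl

/-- A rectangle with `q` coordinates constantly `1` and with `r`, `s`, `t`, `u` coordinates in
the four non-constant column patterns is nondegenerate and monochromatic for `typeColour`. -/
def MonoRectangle (q r s t u : ℕ) : Prop :=
  0 < r + s ∧ 0 < t + u ∧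
    typeColour u t (q + s) = typeColour s r (q + u) ∧
    typeColour u t (q + s) = typeColour (s + u) (r + t) q ∧
    typeColour u t (q + s) = typeColour (s + t) (r + u) q ∧
    typeColour u t (q + s) = typeColour s r (q + t) ∧
    typeColour u t (q + s) = typeColour u t (q + r)

instance (q r s t u : ℕ) : Decidable (MonoRectangle q r s t u) := by
  unfold MonoRectangle
  infer_instance

theorem not_monoRectangle : ∀ q < 10, ∀ r < 10 - q, ∀ s < 10 - (q + r),
    ∀ t < 10 - (q + r + s), ∀ u < 10 - (q + r + s + t),
    ¬ MonoRectangle q r s t u := by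
  decide +kernel

/-- The vertices `a`, `b`, `e`, `d` are, in this order, the corners of a (possibly degenerate)
rectangle: in each coordinate both of the sides `ab`, `de` or both of the sides `ad`, `be` are
constant. -/
def IsRectangle {n : ℕ} (a b d e : Fin n → Bool) : Prop :=
  ∀ i, a i = b i ∧ d i = e i ∨ a i = d i ∧ b i = e i

theorem IsRectangle.not_monochromatic {a b d e : Fin 9 → Bool} (h : IsRectangle a b d e)
    (hab : a ≠ b) (had : a ≠ d) :
    ¬ (typeColouring 9 s(a, b) = typeColouring 9 s(a, d) ∧
      typeColouring 9 s(a, b) = typeColouring 9 s(a, e) ∧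
      typeColouring 9 s(a, b) = typeColouring 9 s(b, d) ∧
      typeColouring 9 s(a, b) = typeColouring 9 s(b, e) ∧
      typeColouring 9 s(a, b) = typeColouring 9 s(d, e)) := by
  set q := ∑ i, (a i && b i && d i).toNat with hq
  set r := ∑ i, (!a i && !b i && d i).toNat with hr
  set s := ∑ i, (a i && b i && !d i).toNat with hs
  set t := ∑ i, (!a i && b i && !d i).toNat with ht
  set u := ∑ i, (a i && !b i && d i).toNat with hu
  have hcard : q + r + s + t + u ≤ 9 := by
    calc q + r + s + t + u ≤ ∑ _i : Fin 9, 1 := by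
          simp only [hq, hr, hs, ht, hu, ← Finset.sum_add_distrib]
          refine Finset.sum_le_sum fun i _ => ?_
          cases a i <;> cases b i <;> cases d i <;> decide
      _ = 9 := by simp
  have hrs : 0 < r + s := by
    by_contra hzero
    have hzero : r + s = 0 := by omega
    simp only [hr, hs, ← Finset.sum_add_distrib, Finset.sum_eq_zero_iff, Finset.mem_univ,
      true_imp_iff] at hzero
    refine had (funext fun i => ?_)
    have hi := hzero i
    have hP := h i
    revert hi hP
    cases a i <;> cases b i <;> cases d i <;> cases e i <;> decide
  have htu : 0 < t + u := by
    by_contra hzero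
    have hzero : t + u = 0 := by omega
    simp only [ht, hu, ← Finset.sum_add_distrib, Finset.sum_eq_zero_iff, Finset.mem_univ,
      true_imp_iff] at hzero
    refine hab (funext fun i => ?_)
    have hi := hzero i
    have hP := h i
    revert hi hP
    cases a i <;> cases b i <;> cases d i <;> cases e i <;> decide
  have key := not_monoRectangle q (by omega) r (by omega) s (by omega) t (by omega) u
    (by omega)
  have count {f g : Fin 9 → ℕ} (hfg : ∀ i, (a i = b i ∧ d i = e i ∨ a i = d i ∧ b i = e i) →
      f i = g i) : ∑ i, f i = ∑ i, g i := Finset.sum_congr rfl fun i _ => hfg i (h i)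
  have hcounts :
      (excess a b = u ∧ excess b a = t ∧ overlap a b = q + s) ∧
      (excess a d = s ∧ excess d a = r ∧ overlap a d = q + u) ∧
      (excess a e = s + u ∧ excess e a = r + t ∧ overlap a e = q) ∧
      (excess b d = s + t ∧ excess d b = r + u ∧ overlap b d = q) ∧
      (excess b e = s ∧ excess e b = r ∧ overlap b e = q + t) ∧
      (excess d e = u ∧ excess e d = t ∧ overlap d e = q + r) := by
    simp only [excess, overlap, hq, hr, hs, ht, hu, ← Finset.sum_add_distrib]
    refine ⟨⟨?_, ?_, ?_⟩, ⟨?_, ?_, ?_⟩, ⟨?_, ?_, ?_⟩, ⟨?_, ?_, ?_⟩, ⟨?_, ?_, ?_⟩,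
      ⟨?_, ?_, ?_⟩⟩ <;>
    · refine count fun i => ?_
      cases a i <;> cases b i <;> cases d i <;> cases e i <;> decide
  obtain ⟨⟨h1, h2, h3⟩, ⟨h4, h5, h6⟩, ⟨h7, h8, h9⟩, ⟨h10, h11, h12⟩, ⟨h13, h14, h15⟩,
    ⟨h16, h17, h18⟩⟩ := hcounts
  simpa only [MonoRectangle, hrs, htu, true_and, typeColouring_mk, h1, h2, h3, h4, h5, h6, h7, h8, h9, h10, h11, h12, h13, h14, h15,
    h16, h17, h18] using key

/-- Distinct vertices of the hypercube admit no nontrivial affine dependence among three of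
them. -/
theorem weights_eq_zero_of_three {n : ℕ} {x y z : Fin n → Bool} (hxy : x ≠ y) (hxz : x ≠ z)
    (hyz : y ≠ z) {α β γ : ℝ} (hsum : α + β + γ = 0)
    (h : ∀ i, α * toPoint n x i + β * toPoint n y i + γ * toPoint n z i = 0) :
    α = 0 ∧ β = 0 ∧ γ = 0 := by
  obtain ⟨i, hi⟩ := Function.ne_iff.1 hxy
  obtain ⟨j, hj⟩ := Function.ne_iff.1 hxz
  obtain ⟨k, hk⟩ := Function.ne_iff.1 hyz
  have h1 : α = 0 ∨ β = 0 := by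
    have := h i
    revert hi this
    cases hx : x i <;> cases hy : y i <;> cases hz : z i <;> simp [toPoint, hx, hy, hz] <;> grind
  have h2 : α = 0 ∨ γ = 0 := by
    have := h j
    revert hj this
    cases hx : x j <;> cases hy : y j <;> cases hz : z j <;> simp [toPoint, hx, hy, hz] <;> grind
  have h3 : β = 0 ∨ γ = 0 := by
    have := h k
    revert hk this
    cases hx : x k <;> cases hy : y k <;> cases hz : z k <;> simp [toPoint, hx, hy, hz] <;> grind
  grind

theorem exists_weights_of_coplanar {n : ℕ} {a b d e : Fin n → ℝ}
    (h : Coplanar ℝ ({a, b, d, e} : Set (Fin n → ℝ))) :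
    ∃ α β γ δ : ℝ, α + β + γ + δ = 0 ∧ ¬ (α = 0 ∧ β = 0 ∧ γ = 0 ∧ δ = 0) ∧
      ∀ i, α * a i + β * b i + γ * d i + δ * e i = 0 := by
  have hrange : Set.range ![a, b, d, e] = {a, b, d, e} := by
    simp only [Matrix.range_cons, Matrix.range_empty, Set.union_empty, Set.singleton_union]
  rw [coplanar_iff_finrank_le_two, ← hrange,
    finrank_vectorSpan_le_iff_not_affineIndependent ℝ _ (by simp : Fintype.card (Fin 4) = 2 + 2),
    affineIndependent_iff] at h
  push Not at h
  obtain ⟨s, w, hw, hsum, i, hi, hne⟩ := h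
  let w' : Fin 4 → ℝ := fun j => if j ∈ s then w j else 0
  have hw' : ∑ j, w' j = 0 := by simpa [w', Finset.sum_ite_mem] using hw
  have hsum' : ∑ j, w' j • ![a, b, d, e] j = 0 := by
    simpa [w', ite_smul, Finset.sum_ite_mem] using hsum
  refine ⟨w' 0, w' 1, w' 2, w' 3, by simpa [Fin.sum_univ_four] using hw', ?_, fun k => ?_⟩
  · rintro ⟨h0, h1, h2, h3⟩
    have : w' i = 0 := by fin_cases i <;> assumption
    simp only [w', hi, if_true] at this
    exact hne this
  · simpa [Fin.sum_univ_four] using congrFun hsum' k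

/-- Four distinct coplanar vertices of the hypercube are the corners of a rectangle. -/
theorem isRectangle_of_coplanar {n : ℕ} {a b d e : Fin n → Bool} (hab : a ≠ b) (had : a ≠ d)
    (hae : a ≠ e) (hbd : b ≠ d) (hbe : b ≠ e) (hde : d ≠ e)
    (h : Coplanar ℝ
      ({toPoint n a, toPoint n b, toPoint n d, toPoint n e} : Set (Fin n → ℝ))) :
    IsRectangle a b d e ∨ IsRectangle a b e d ∨ IsRectangle a d e b := by
  obtain ⟨α, β, γ, δ, hsum, hne, hw⟩ := exists_weights_of_coplanar h
  have hα : α ≠ 0 := by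
    rintro rfl
    exact hne ⟨rfl, weights_eq_zero_of_three hbd hbe hde (by linarith) fun i => by
      linarith [hw i]⟩
  have hβ : β ≠ 0 := by
    rintro rfl
    have := weights_eq_zero_of_three (α := α) (β := γ) (γ := δ) had hae hde (by linarith) fun i => by
      linarith [hw i]
    tauto
  have hγ : γ ≠ 0 := by
    rintro rfl
    have := weights_eq_zero_of_three (α := α) (β := β) (γ := δ) hab hae hbe (by linarith) fun i => by
      linarith [hw i]
    tauto
  have hδ : δ ≠ 0 := by
    rintro rfl
    have := weights_eq_zero_of_three (α := α) (β := β) (γ := γ) hab had hbd (by linarith) fun i => by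
      linarith [hw i]
    tauto
  by_contra hrect
  simp only [IsRectangle, not_or, not_forall] at hrect
  obtain ⟨⟨i, hi⟩, ⟨j, hj⟩, ⟨k, hk⟩⟩ := hrect
  have h1 : β + γ = 0 := by
    have := hw i
    revert hi this
    cases ha : a i <;> cases hb : b i <;> cases hd : d i <;> cases he : e i <;>
      simp [toPoint, ha, hb, hd, he] <;> grind
  have h2 : β + δ = 0 := by
    have := hw j
    revert hj this
    cases ha : a j <;> cases hb : b j <;> cases hd : d j <;> cases he : e j <;>
      simp [toPoint, ha, hb, hd, he] <;> grind
  have h3 : γ + δ = 0 := by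
    have := hw k
    revert hk this
    cases ha : a k <;> cases hb : b k <;> cases hd : d k <;> cases he : e k <;>
      simp [toPoint, ha, hb, hd, he] <;> grind
  exact hβ (by linarith)

theorem noMonoPlanarK4_typeColouring : NoMonoPlanarK4 9 (typeColouring 9) := by
  rintro a b d e hab had hae hbd hbe hde hcop ⟨h1, h2, h3, h4, h5⟩
  rcases isRectangle_of_coplanar hab had hae hbd hbe hde hcop with h | h | h
  · exact h.not_monochromatic hab had ⟨h1, h2, h3, h4, h5⟩
  · exact h.not_monochromatic hab hae ⟨h2, h1, h4, h3, by rwa [Sym2.eq_swap (a := e)]⟩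
  · refine h.not_monochromatic had hae ⟨h1.symm.trans h2, h1.symm, h1.symm.trans h5, ?_, ?_⟩
    · rw [Sym2.eq_swap (a := d) (b := b)]
      exact h1.symm.trans h3
    · rw [Sym2.eq_swap (a := e) (b := b)]
      exact h1.symm.trans h4

theorem invariantUnder_typeColouring (n : ℕ) (G : Subgroup (Equiv.Perm (Fin n))) :
    InvariantUnder n G (typeColouring n) := fun σ _ u v _ => by
  simp only [typeColouring_mk, excess_permAct, overlap_permAct]

theorem exists_invariant_good_colouring_C9 (G : Subgroup (Equiv.Perm (Fin 9))) :
    ∃ c : Sym2 (Fin 9 → Bool) → Bool, NoMonoPlanarK4 9 c ∧ InvariantUnder 9 G c :=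
  ⟨typeColouring 9, noMonoPlanarK4_typeColouring, invariantUnder_typeColouring 9 G⟩
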